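/- Let A, B be smooth real-valued functions of coordinates including x, y, a, b (with a, b distinct coordinates different from x, y), let λ ∈ ℝ and n, s ∈ ℕ. Define the operators on smooth functions f: P f = f_a − λⁿ f_x − X_A f and Q f = f_b − λˢ f_x − X_B f, where X_H f = H_x f_y − H_y f_x. Then for every smooth f, P(Q f) − Q(P f) = X_E f, where E = ∂_b A − ∂_a B + λⁿ B_x − λˢ A_x + {A, B} and {A,B} = A_x B_y − A_y B_x. Consequently P and Q commute if and only if ∂_x E = ∂_y E = 0. -/

import Mathlib

/-- Partial derivative of `f` in the `i`-th coordinate direction. -/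
noncomputable def pd {n : ℕ} (i : Fin n) (f : (Fin n → ℝ) → ℝ) : (Fin n → ℝ) → ℝ :=
  fun p => fderiv ℝ f p (Pi.single i 1)

/-- Hamiltonian vector field `X_H f = H_x f_y − H_y f_x` in the coordinates `ix`, `iy`. -/
noncomputable def ham {n : ℕ} (ix iy : Fin n) (H f : (Fin n → ℝ) → ℝ) :
    (Fin n → ℝ) → ℝ :=
  fun q => pd ix H q * pd iy f q - pd iy H q * pd ix f q

/-- `P f = f_a − λⁿ f_x − X_A f`. -/
noncomputable def Pop {d : ℕ} (ix iy ia : Fin d) (lam : ℝ) (n : ℕ)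
    (A f : (Fin d → ℝ) → ℝ) : (Fin d → ℝ) → ℝ :=
  fun q => pd ia f q - lam ^ n * pd ix f q - ham ix iy A f q

section PartialDerivatives

variable {d : ℕ}

theorem ContDiff.pd {f : (Fin d → ℝ) → ℝ} (hf : ContDiff ℝ (⊤ : ℕ∞) f) (i : Fin d) :
    ContDiff ℝ (⊤ : ℕ∞) (pd i f) :=
  (hf.fderiv_right (m := (⊤ : ℕ∞)) le_rfl).clm_apply contDiff_const

theorem ContDiff.differentiable_pd {f : (Fin d → ℝ) → ℝ} (hf : ContDiff ℝ (⊤ : ℕ∞) f)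
    (i : Fin d) : Differentiable ℝ (_root_.pd i f) :=
  (hf.pd i).differentiable (by simp)

theorem pd_fun_add {f g : (Fin d → ℝ) → ℝ} (hf : Differentiable ℝ f) (hg : Differentiable ℝ g)
    (i : Fin d) (q : Fin d → ℝ) : pd i (fun r => f r + g r) q = pd i f q + pd i g q := by
  simp only [pd, fderiv_fun_add (hf q) (hg q), add_apply]

theorem pd_fun_sub {f g : (Fin d → ℝ) → ℝ} (hf : Differentiable ℝ f) (hg : Differentiable ℝ g)
    (i : Fin d) (q : Fin d → ℝ) : pd i (fun r => f r - g r) q = pd i f q - pd i g q := by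
  simp only [pd, fderiv_fun_sub (hf q) (hg q), sub_apply]

theorem pd_fun_mul {f g : (Fin d → ℝ) → ℝ} (hf : Differentiable ℝ f) (hg : Differentiable ℝ g)
    (i : Fin d) (q : Fin d → ℝ) :
    pd i (fun r => f r * g r) q = f q * pd i g q + pd i f q * g q := by
  simp only [pd, fderiv_fun_mul (hf q) (hg q), add_apply,
    smul_apply, smul_eq_mul]
  ring

theorem pd_const_mul {f : (Fin d → ℝ) → ℝ} (hf : Differentiable ℝ f) (c : ℝ)
    (i : Fin d) (q : Fin d → ℝ) : pd i (fun r => c * f r) q = c * pd i f q := by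
  simp only [pd, fderiv_const_mul (hf q), smul_apply, smul_eq_mul]

theorem pd_pd_eq {f : (Fin d → ℝ) → ℝ} (hf : Differentiable ℝ (fderiv ℝ f))
    (i j : Fin d) (q : Fin d → ℝ) :
    pd i (pd j f) q = fderiv ℝ (fderiv ℝ f) q (Pi.single i 1) (Pi.single j 1) := by
  unfold pd
  rw [fderiv_clm_apply (hf q) (differentiableAt_const _)]
  simp

theorem pd_comm {f : (Fin d → ℝ) → ℝ} (hf : ContDiff ℝ (⊤ : ℕ∞) f)
    (i j : Fin d) (q : Fin d → ℝ) : pd i (pd j f) q = pd j (pd i f) q := by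
  have hd : Differentiable ℝ (fderiv ℝ f) :=
    (hf.fderiv_right (m := (⊤ : ℕ∞)) le_rfl).differentiable (by simp)
  rw [pd_pd_eq hd, pd_pd_eq hd]
  refine (hf.contDiffAt.isSymmSndFDerivAt ?_).eq _ _
  simp only [minSmoothness_of_isRCLikeNormedField]
  exact WithTop.coe_le_coe.mpr (le_top : (2 : ℕ∞) ≤ ⊤)

theorem pd_coord (i j : Fin d) (q : Fin d → ℝ) :
    pd i (fun r => r j) q = (Pi.single i 1 : Fin d → ℝ) j := by
  rw [pd, (hasFDerivAt_apply j q).fderiv, ContinuousLinearMap.proj_apply]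

theorem differentiable_ham {f g : (Fin d → ℝ) → ℝ} (hf : ContDiff ℝ (⊤ : ℕ∞) f)
    (hg : ContDiff ℝ (⊤ : ℕ∞) g) (ix iy : Fin d) : Differentiable ℝ (ham ix iy f g) :=
  ((hf.differentiable_pd ix).fun_mul (hg.differentiable_pd iy)).fun_sub
    ((hf.differentiable_pd iy).fun_mul (hg.differentiable_pd ix))

theorem pd_ham {f g : (Fin d → ℝ) → ℝ} (hf : ContDiff ℝ (⊤ : ℕ∞) f)
    (hg : ContDiff ℝ (⊤ : ℕ∞) g) (ix iy k : Fin d) (q : Fin d → ℝ) :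
    pd k (ham ix iy f g) q = ham ix iy (pd k f) g q + ham ix iy f (pd k g) q := by
  unfold ham
  rw [pd_fun_sub ((hf.differentiable_pd ix).fun_mul (hg.differentiable_pd iy))
    ((hf.differentiable_pd iy).fun_mul (hg.differentiable_pd ix)),
    pd_fun_mul (hf.differentiable_pd ix) (hg.differentiable_pd iy),
    pd_fun_mul (hf.differentiable_pd iy) (hg.differentiable_pd ix),
    pd_comm hf k ix, pd_comm hf k iy, pd_comm hg k ix, pd_comm hg k iy]
  ring

theorem pd_Pop {A f : (Fin d → ℝ) → ℝ} (hA : ContDiff ℝ (⊤ : ℕ∞) A)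
    (hf : ContDiff ℝ (⊤ : ℕ∞) f) (ix iy ia k : Fin d) (lam : ℝ) (n : ℕ) (q : Fin d → ℝ) :
    pd k (Pop ix iy ia lam n A f) q
      = pd k (pd ia f) q - lam ^ n * pd k (pd ix f) q
        - (ham ix iy (pd k A) f q + ham ix iy A (pd k f) q) := by
  unfold Pop
  rw [pd_fun_sub ((hf.differentiable_pd ia).fun_sub ((hf.differentiable_pd ix).const_mul _))
    (differentiable_ham hA hf ix iy),
    pd_fun_sub (hf.differentiable_pd ia) ((hf.differentiable_pd ix).const_mul _),
    pd_const_mul (hf.differentiable_pd ix), pd_ham hA hf]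

theorem pd_zeroCurvature {A B : (Fin d → ℝ) → ℝ} (hA : ContDiff ℝ (⊤ : ℕ∞) A)
    (hB : ContDiff ℝ (⊤ : ℕ∞) B) (ix iy ia ib k : Fin d) (c e : ℝ) (q : Fin d → ℝ) :
    pd k (fun r => pd ib A r - pd ia B r + c * pd ix B r - e * pd ix A r + ham ix iy A B r) q
      = pd k (pd ib A) q - pd k (pd ia B) q + c * pd k (pd ix B) q - e * pd k (pd ix A) q
        + (ham ix iy (pd k A) B q + ham ix iy A (pd k B) q) := by
  have hAb := hA.differentiable_pd ib
  have hBa := hB.differentiable_pd ia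
  have hBx := (hB.differentiable_pd ix).const_mul c
  have hAx := (hA.differentiable_pd ix).const_mul e
  rw [pd_fun_add (((hAb.fun_sub hBa).fun_add hBx).fun_sub hAx) (differentiable_ham hA hB ix iy),
    pd_fun_sub ((hAb.fun_sub hBa).fun_add hBx) hAx, pd_fun_add (hAb.fun_sub hBa) hBx, pd_fun_sub hAb hBa,
    pd_const_mul (hB.differentiable_pd ix), pd_const_mul (hA.differentiable_pd ix), pd_ham hA hB]

theorem Pop_commutator {A B f : (Fin d → ℝ) → ℝ} (hA : ContDiff ℝ (⊤ : ℕ∞) A)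
    (hB : ContDiff ℝ (⊤ : ℕ∞) B) (hf : ContDiff ℝ (⊤ : ℕ∞) f) (ix iy ia ib : Fin d)
    (lam : ℝ) (n s : ℕ) (q : Fin d → ℝ) :
    Pop ix iy ia lam n A (Pop ix iy ib lam s B f) q
        - Pop ix iy ib lam s B (Pop ix iy ia lam n A f) q
      = ham ix iy (fun r => pd ib A r - pd ia B r + lam ^ n * pd ix B r
          - lam ^ s * pd ix A r + ham ix iy A B r) f q := by
  have Pop_eq (C g : (Fin d → ℝ) → ℝ) (j : Fin d) (m : ℕ) : Pop ix iy j lam m C g q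
      = pd j g q - lam ^ m * pd ix g q - (pd ix C q * pd iy g q - pd iy C q * pd ix g q) := rfl
  have ham_eq (H g : (Fin d → ℝ) → ℝ) : ham ix iy H g q
      = pd ix H q * pd iy g q - pd iy H q * pd ix g q := rfl
  simp only [Pop_eq, pd_Pop hA hf, pd_Pop hB hf, ham_eq, pd_zeroCurvature hA hB]
  rw [pd_comm hf ib ia, pd_comm hf ix ia, pd_comm hf iy ia, pd_comm hf ix ib, pd_comm hf iy ib,
    pd_comm hf iy ix, pd_comm hA ix ib, pd_comm hA iy ib, pd_comm hA iy ix, pd_comm hB ix ia,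
    pd_comm hB iy ia, pd_comm hB iy ix]
  ring

end PartialDerivatives

/-- `P(Q f) − Q(P f) = X_E f` where
`E = ∂_b A − ∂_a B + λⁿ B_x − λˢ A_x + {A,B}`; consequently `P` and `Q` commute iff
`∂_x E = ∂_y E = 0`. -/
theorem stmt15 {d : ℕ} (ix iy ia ib : Fin d)
    (hxy : ix ≠ iy) (hab : ia ≠ ib) (hax : ia ≠ ix) (hay : ia ≠ iy)
    (hbx : ib ≠ ix) (hby : ib ≠ iy)
    (A B : (Fin d → ℝ) → ℝ) (hA : ContDiff ℝ (⊤ : ℕ∞) A) (hB : ContDiff ℝ (⊤ : ℕ∞) B)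
    (lam : ℝ) (n s : ℕ) :
    (∀ f : (Fin d → ℝ) → ℝ, ContDiff ℝ (⊤ : ℕ∞) f → ∀ q,
        Pop ix iy ia lam n A (Pop ix iy ib lam s B f) q
            - Pop ix iy ib lam s B (Pop ix iy ia lam n A f) q
          = ham ix iy (fun r => pd ib A r - pd ia B r + lam ^ n * pd ix B r
              - lam ^ s * pd ix A r + ham ix iy A B r) f q)
    ∧ ((∀ f : (Fin d → ℝ) → ℝ, ContDiff ℝ (⊤ : ℕ∞) f → ∀ q,
          Pop ix iy ia lam n A (Pop ix iy ib lam s B f) q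
            = Pop ix iy ib lam s B (Pop ix iy ia lam n A f) q)
        ↔ (∀ q, pd ix (fun r => pd ib A r - pd ia B r + lam ^ n * pd ix B r
              - lam ^ s * pd ix A r + ham ix iy A B r) q = 0
            ∧ pd iy (fun r => pd ib A r - pd ia B r + lam ^ n * pd ix B r
              - lam ^ s * pd ix A r + ham ix iy A B r) q = 0)) := by
  refine ⟨fun f hf q => Pop_commutator hA hB hf ix iy ia ib lam n s q, fun h q => ?_,
    fun h f hf q => ?_⟩
  · have coord (j : Fin d) := (Pop_commutator hA hB (contDiff_apply ℝ ℝ j)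
      ix iy ia ib lam n s q).symm.trans (sub_eq_zero.mpr (h _ (contDiff_apply ℝ ℝ j) q))
    constructor
    · simpa [ham, pd_coord, hxy, hxy.symm] using coord iy
    · simpa [ham, pd_coord, hxy, hxy.symm] using coord ix
  · rw [← sub_eq_zero, Pop_commutator hA hB hf, ham, (h q).1, (h q).2]
    ring
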